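/- arXiv:math/0412308 — 2 statements merged into one kernel-verified Lean document; each statement's English description precedes it below -/
import Mathlib

section
/- If α > -1/2, then there exists a constant C > 0 such that ‖u‖² + ‖Wu‖² + ‖W̄u‖² ≤ C ‖(α+W)u‖² for all u in W₀; consequently the bounded operator W + α : W₀ → L²(D) is injective with closed range. -/
open MeasureTheory Complex Filter Topology Metric
open scoped ENNReal NNReal InnerProductSpace

noncomputable section

/-- The Wirtinger derivative `∂f/∂w = ((∂/∂t) f - i (∂/∂s) f)/2`. -/
def dw (f : ℂ → ℂ) (w : ℂ) : ℂ :=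
  (fderiv ℝ f w 1 - Complex.I * fderiv ℝ f w Complex.I) / 2

/-- The Wirtinger derivative `∂f/∂w̄ = ((∂/∂t) f + i (∂/∂s) f)/2`. -/
def dwbar (f : ℂ → ℂ) (w : ℂ) : ℂ :=
  (fderiv ℝ f w 1 + Complex.I * fderiv ℝ f w Complex.I) / 2

/-- The vector field `W = 2 i s ∂/∂w` acting on functions. -/
def Wop (f : ℂ → ℂ) (w : ℂ) : ℂ := 2 * Complex.I * (w.im : ℂ) * dw f w

/-- The vector field `W̄ = -2 i s ∂/∂w̄` acting on functions. -/
def Wbar (f : ℂ → ℂ) (w : ℂ) : ℂ := -(2 * Complex.I * (w.im : ℂ)) * dwbar f w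

/-- The upper half-plane `H² = {w : Im w > 0}` as a subset of `ℂ`. -/
def UHP : Set ℂ := {w : ℂ | 0 < w.im}

/-- The squared `L²` norm on `D` with respect to the hyperbolic measure `s⁻² dt ds`. -/
def hNormSq (D : Set ℂ) (f : ℂ → ℂ) : ℝ≥0∞ :=
  ∫⁻ w in D, (‖f w‖₊ : ℝ≥0∞) ^ 2 * ENNReal.ofReal ((w.im)⁻¹ ^ 2)

/-- The hyperbolic `L²` inner product `⟨f, g⟩ = ∫_D f ḡ s⁻² dt ds` on `D`. -/
def hInner (D : Set ℂ) (f g : ℂ → ℂ) : ℂ :=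
  ∫ w in D, f w * (starRingEnd ℂ) (g w) * ((((w.im)⁻¹ ^ 2 : ℝ)) : ℂ)

/-- Smooth functions compactly supported in `D`. -/
def IsTestFun (D : Set ℂ) (f : ℂ → ℂ) : Prop :=
  ContDiff ℝ (⊤ : ℕ∞) f ∧ HasCompactSupport f ∧ tsupport f ⊆ D

/-- `u` belongs to `W₀`, the closure of `C_c^∞(D)` in the first-order Sobolev norm
`‖u‖² + ‖Wu‖² + ‖W̄u‖²`, with `Wu`, `Wbu` the induced extensions of `W u` and `W̄ u`. -/
def MemW0 (D : Set ℂ) (u Wu Wbu : ℂ → ℂ) : Prop :=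
  AEStronglyMeasurable u (volume.restrict D) ∧
  AEStronglyMeasurable Wu (volume.restrict D) ∧
  AEStronglyMeasurable Wbu (volume.restrict D) ∧
  ∃ φ : ℕ → ℂ → ℂ, (∀ n, IsTestFun D (φ n)) ∧
    Tendsto (fun n => hNormSq D (fun w => φ n w - u w)) atTop (𝓝 0) ∧
    Tendsto (fun n => hNormSq D (fun w => Wop (φ n) w - Wu w)) atTop (𝓝 0) ∧
    Tendsto (fun n => hNormSq D (fun w => Wbar (φ n) w - Wbu w)) atTop (𝓝 0)

/-- Membership in `L²(D)` with respect to the hyperbolic measure. -/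
def HMemL2 (D : Set ℂ) (f : ℂ → ℂ) : Prop :=
  AEStronglyMeasurable f (volume.restrict D) ∧ hNormSq D f < ⊤

/-- The hyperbolic measure `s⁻² dt ds` restricted to `D`. -/
def hypMeasure (D : Set ℂ) : Measure ℂ :=
  (volume.restrict D).withDensity fun w => ENNReal.ofReal ((w.im)⁻¹ ^ 2)

lemma measurable_hypDensity : Measurable fun w : ℂ => ENNReal.ofReal ((w.im)⁻¹ ^ 2) := by
  fun_prop

lemma hNormSq_eq_eLpNorm_sq (D : Set ℂ) (f : ℂ → ℂ) :
    hNormSq D f = eLpNorm f 2 (hypMeasure D) ^ 2 := by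
  have h := eLpNorm_nnreal_pow_eq_lintegral (f := f) (μ := hypMeasure D) (p := 2) (by norm_num)
  have h2 : eLpNorm f 2 (hypMeasure D) ^ 2 = ∫⁻ w, ‖f w‖ₑ ^ 2 ∂(hypMeasure D) := by
    simpa using h
  rw [h2, hypMeasure, lintegral_withDensity_eq_lintegral_mul_non_measurable _
    measurable_hypDensity (by simp)]
  simp [hNormSq, enorm, mul_comm]

lemma tendsto_hNormSq_zero_iff {ι : Type*} {l : Filter ι} {D : Set ℂ} {f : ι → ℂ → ℂ} :
    Tendsto (fun n => hNormSq D (f n)) l (𝓝 0) ↔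
      Tendsto (fun n => eLpNorm (f n) 2 (hypMeasure D)) l (𝓝 0) := by
  simp_rw [hNormSq_eq_eLpNorm_sq]
  refine ⟨fun h => ?_, fun h => ?_⟩
  · have hpow : ∀ x : ℝ≥0∞, (x ^ 2) ^ (2⁻¹ : ℝ) = x := fun x => by
      rw [← ENNReal.rpow_two, ← ENNReal.rpow_mul]
      norm_num
    have := (ENNReal.continuous_rpow_const (y := (1 / 2 : ℝ))).tendsto 0 |>.comp h
    simpa [Function.comp_def, hpow] using this
  · simpa [Function.comp_def] using (ENNReal.continuous_pow 2).tendsto 0 |>.comp h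

lemma aestronglyMeasurable_hypMeasure {D : Set ℂ} {f : ℂ → ℂ}
    (hf : AEStronglyMeasurable f (volume.restrict D)) :
    AEStronglyMeasurable f (hypMeasure D) :=
  hf.mono_ac (withDensity_absolutelyContinuous _ _)

lemma integral_hypMeasure {E : Type*} [NormedAddCommGroup E] [NormedSpace ℝ E]
    (D : Set ℂ) (f : ℂ → E) :
    ∫ w, f w ∂(hypMeasure D) = ∫ w in D, ((w.im)⁻¹ ^ 2 : ℝ) • f w := by
  rw [hypMeasure, integral_withDensity_eq_integral_toReal_smul measurable_hypDensity (by simp)]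
  simp_rw [ENNReal.toReal_ofReal (sq_nonneg _)]

lemma ae_mem_hypMeasure {D : Set ℂ} (hD : IsOpen D) : ∀ᵐ w ∂(hypMeasure D), w ∈ D :=
  (withDensity_absolutelyContinuous _ _).ae_le (ae_restrict_mem hD.measurableSet)

lemma hypMeasure_lt_top_of_isCompact {D K : Set ℂ} (hK : IsCompact K) (hKU : K ⊆ UHP) :
    hypMeasure D K < ⊤ := by
  rw [hypMeasure, withDensity_apply _ hK.measurableSet]
  have hc : ContinuousOn (fun w : ℂ => (w.im)⁻¹ ^ 2) K :=
    (Complex.continuous_im.continuousOn.inv₀ fun w hw => (hKU hw).ne').pow 2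
  have hi : IntegrableOn (fun w : ℂ => (w.im)⁻¹ ^ 2) K volume := hc.integrableOn_compact hK
  have := hi.lintegral_lt_top
  refine lt_of_le_of_lt (lintegral_mono' ?_ le_rfl) this
  exact Measure.restrict_mono' Filter.EventuallyLE.rfl Measure.restrict_le_self

lemma memLp_hypMeasure_of_continuous {D K : Set ℂ} {g : ℂ → ℂ} (hg : Continuous g)
    (hK : IsCompact K) (hKU : K ⊆ UHP) (h0 : ∀ w ∉ K, g w = 0) :
    MemLp g 2 (hypMeasure D) := by
  have hind : K.indicator g = g := Set.indicator_eq_self.2 fun w hw => by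
    by_contra h
    exact hw (h0 w h)
  rw [← hind, memLp_indicator_iff_restrict hK.measurableSet]
  have : IsFiniteMeasure ((hypMeasure D).restrict K) :=
    ⟨by simpa using hypMeasure_lt_top_of_isCompact (D := D) hK hKU⟩
  exact hg.memLp_of_hasCompactSupport (HasCompactSupport.intro hK h0)

namespace IsTestFun

variable {D : Set ℂ} {φ ψ : ℂ → ℂ}

lemma fderiv_eq_zero {w : ℂ} (hw : w ∉ tsupport φ) : fderiv ℝ φ w = 0 := by
  by_contra h
  exact hw (support_fderiv_subset ℝ h)

lemma differentiable (h : IsTestFun D φ) : Differentiable ℝ φ :=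
  h.1.differentiable (by simp)

lemma contDiff_fderiv (h : IsTestFun D φ) : ContDiff ℝ 1 (fderiv ℝ φ) :=
  have h2 : ContDiff ℝ 2 φ := contDiff_infty.1 h.1 2
  h2.fderiv_right (by norm_num)

lemma contDiff_fderiv_apply (h : IsTestFun D φ) (v : ℂ) :
    ContDiff ℝ 1 fun w => fderiv ℝ φ w v :=
  h.contDiff_fderiv.clm_apply contDiff_const

lemma zero : IsTestFun D 0 :=
  ⟨contDiff_const, HasCompactSupport.zero, by simp [tsupport]⟩

lemma add (h : IsTestFun D φ) (h' : IsTestFun D ψ) : IsTestFun D (φ + ψ) :=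
  ⟨h.1.add h'.1, h.2.1.add h'.2.1,
    (tsupport_add φ ψ).trans (Set.union_subset h.2.2 h'.2.2)⟩

lemma const_smul (c : ℂ) (h : IsTestFun D φ) : IsTestFun D (c • φ) :=
  ⟨h.1.const_smul c, h.2.1.smul_left (f := fun _ => c),
    (tsupport_smul_subset_right (fun _ => c) φ).trans h.2.2⟩

lemma memLp (hDU : D ⊆ UHP) (h : IsTestFun D φ) : MemLp φ 2 (hypMeasure D) :=
  memLp_hypMeasure_of_continuous h.1.continuous h.2.1 (h.2.2.trans hDU)
    fun _ hw => image_eq_zero_of_notMem_tsupport hw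

lemma memLp_Wop (hDU : D ⊆ UHP) (h : IsTestFun D φ) : MemLp (Wop φ) 2 (hypMeasure D) := by
  refine memLp_hypMeasure_of_continuous ?_ h.2.1 (h.2.2.trans hDU) fun w hw => ?_
  · have h1 := (h.contDiff_fderiv_apply 1).continuous
    have h2 := (h.contDiff_fderiv_apply I).continuous
    unfold Wop dw
    fun_prop
  · simp [Wop, dw, fderiv_eq_zero hw]

lemma memLp_Wbar (hDU : D ⊆ UHP) (h : IsTestFun D φ) : MemLp (Wbar φ) 2 (hypMeasure D) := by
  refine memLp_hypMeasure_of_continuous ?_ h.2.1 (h.2.2.trans hDU) fun w hw => ?_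
  · have h1 := (h.contDiff_fderiv_apply 1).continuous
    have h2 := (h.contDiff_fderiv_apply I).continuous
    unfold Wbar dwbar
    fun_prop
  · simp [Wbar, dwbar, fderiv_eq_zero hw]

lemma Wop_add (h : IsTestFun D φ) (h' : IsTestFun D ψ) : Wop (φ + ψ) = Wop φ + Wop ψ := by
  ext w
  simp only [Wop, dw, Pi.add_apply, fderiv_add (h.differentiable w) (h'.differentiable w),
    _root_.add_apply]
  ring

lemma Wbar_add (h : IsTestFun D φ) (h' : IsTestFun D ψ) :
    Wbar (φ + ψ) = Wbar φ + Wbar ψ := by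
  ext w
  simp only [Wbar, dwbar, Pi.add_apply, fderiv_add (h.differentiable w) (h'.differentiable w),
    _root_.add_apply]
  ring

lemma Wop_const_smul (c : ℂ) (h : IsTestFun D φ) : Wop (c • φ) = c • Wop φ := by
  ext w
  simp only [Wop, dw, Pi.smul_apply, fderiv_const_smul (h.differentiable w),
    _root_.smul_apply, smul_eq_mul]
  ring

lemma Wbar_const_smul (c : ℂ) (h : IsTestFun D φ) : Wbar (c • φ) = c • Wbar φ := by
  ext w
  simp only [Wbar, dwbar, Pi.smul_apply, fderiv_const_smul (h.differentiable w),
    _root_.smul_apply, smul_eq_mul]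
  ring

end IsTestFun

lemma integrable_fderiv_apply {g : ℂ → ℝ} (hg : ContDiff ℝ 1 g)
    (hc : HasCompactSupport g) (v : ℂ) : Integrable fun w => fderiv ℝ g w v :=
  ((hg.continuous_fderiv (by simp)).clm_apply continuous_const).integrable_of_hasCompactSupport
    (hc.fderiv_apply ℝ v)

lemma setIntegral_fderiv_eq_zero {D : Set ℂ} {g : ℂ → ℝ} (hg : ContDiff ℝ 1 g)
    (hc : HasCompactSupport g) (hs : tsupport g ⊆ D) (v : ℂ) :
    ∫ w in D, fderiv ℝ g w v = 0 := by
  rw [setIntegral_eq_integral_of_forall_compl_eq_zero fun w hw => ?_]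
  · have hd : Differentiable ℝ g := hg.differentiable (by simp)
    simpa using integral_mul_fderiv_eq_neg_fderiv_mul_of_integrable (μ := (volume : Measure ℂ))
      (f := fun _ : ℂ => (1 : ℝ)) (g := g) (v := v) (by simp)
      (by simpa using integrable_fderiv_apply hg hc v)
      (by simpa using hg.continuous.integrable_of_hasCompactSupport hc)
      (by simp) (fun w _ => hd w)
  · by_contra h
    exact hw (hs (support_fderiv_subset ℝ fun h' => h (by simp [h'])))

namespace IsTestFun

variable {D : Set ℂ} {φ : ℂ → ℂ}

/-- `2 Re ⟨s ∂φ/∂s, φ⟩ = ‖φ‖²`, in terms of `W + W̄ = 2 s ∂/∂s`. -/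
lemma integral_re_inner_self_Wop_add_Wbar (hD : IsOpen D) (hDU : D ⊆ UHP) (h : IsTestFun D φ) :
    ∫ w, (RCLike.re (inner ℂ (φ w) (Wop φ w + Wbar φ w)) - RCLike.re (inner ℂ (φ w) (φ w)))
      ∂(hypMeasure D) = 0 := by
  have hsub : tsupport (fun w : ℂ => inner ℝ (φ w) (φ w) * (w.im)⁻¹) ⊆ tsupport φ := by
    refine closure_mono fun w hw hφ => hw ?_
    simp [hφ]
  have him : ∀ w : ℂ, HasFDerivAt (fun w : ℂ => w.im) Complex.imCLM w :=
    fun w => Complex.imCLM.hasFDerivAt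
  have hsm : ContDiff ℝ 1 (fun w : ℂ => inner ℝ (φ w) (φ w) * (w.im)⁻¹) := by
    refine contDiff_iff_contDiffAt.2 fun w => ?_
    by_cases hw : w ∈ tsupport fun w : ℂ => inner ℝ (φ w) (φ w) * (w.im)⁻¹
    swap
    · exact contDiffAt_const.congr_of_eventuallyEq (notMem_tsupport_iff_eventuallyEq.1 hw)
    have hw' : w.im ≠ 0 := (hDU (h.2.2 (hsub hw))).ne'
    have hφ : ContDiffAt ℝ 1 φ w := (h.1.of_le (by exact_mod_cast le_top)).contDiffAt
    exact (hφ.inner ℝ hφ).mul (Complex.imCLM.contDiff.contDiffAt.inv hw')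
  rw [integral_hypMeasure, ← setIntegral_fderiv_eq_zero hsm
    (h.2.1.mono' ((subset_tsupport _).trans hsub)) (hsub.trans h.2.2) I]
  refine setIntegral_congr_fun hD.measurableSet fun w hw => ?_
  have hw' : w.im ≠ 0 := (hDU hw).ne'
  have hd := (((h.differentiable w).hasFDerivAt.inner ℝ (h.differentiable w).hasFDerivAt).mul
    ((hasDerivAt_inv hw').comp_hasFDerivAt w (him w))).fderiv
  change fderiv ℝ (fun w : ℂ => inner ℝ (φ w) (φ w) * (w.im)⁻¹) w = _ at hd
  rw [hd]
  simp [Wop, Wbar, dw, dwbar, -inner_self_eq_norm_sq_to_K]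
  field_simp
  ring

/-- `‖Wφ‖ = ‖W̄φ‖`. -/
lemma integral_inner_Wop_sub_inner_Wbar (hD : IsOpen D) (hDU : D ⊆ UHP) (h : IsTestFun D φ) :
    ∫ w, (RCLike.re (inner ℂ (Wop φ w) (Wop φ w)) - RCLike.re (inner ℂ (Wbar φ w) (Wbar φ w)))
      ∂(hypMeasure D) = 0 := by
  have hsub : ∀ v : ℂ,
      tsupport (fun w : ℂ => inner ℝ (I * fderiv ℝ φ w v) (φ w)) ⊆ tsupport φ := by
    refine fun v => closure_mono fun w hw hφ => hw ?_
    simp [hφ]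
  have hcs : ∀ v : ℂ, HasCompactSupport (fun w : ℂ => inner ℝ (I * fderiv ℝ φ w v) (φ w)) :=
    fun v => h.2.1.mono' ((subset_tsupport _).trans (hsub v))
  have hφ : ContDiff ℝ 1 φ := h.1.of_le (by exact_mod_cast le_top)
  have hsm : ∀ v : ℂ, ContDiff ℝ 1 (fun w : ℂ => inner ℝ (I * fderiv ℝ φ w v) (φ w)) :=
    fun v => (contDiff_const.mul (h.contDiff_fderiv_apply v)).inner ℝ hφ
  have key : ∫ w in D, (2 * (fderiv ℝ (fun w : ℂ => inner ℝ (I * fderiv ℝ φ w 1) (φ w)) w I -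
      fderiv ℝ (fun w : ℂ => inner ℝ (I * fderiv ℝ φ w I) (φ w)) w 1)) = 0 := by
    rw [integral_const_mul, integral_sub (integrable_fderiv_apply (hsm _) (hcs _) _).integrableOn
      (integrable_fderiv_apply (hsm _) (hcs _) _).integrableOn,
      setIntegral_fderiv_eq_zero (hsm _) (hcs _) ((hsub _).trans h.2.2),
      setIntegral_fderiv_eq_zero (hsm _) (hcs _) ((hsub _).trans h.2.2)]
    simp
  rw [integral_hypMeasure, ← key]
  refine setIntegral_congr_fun hD.measurableSet fun w hw => ?_
  have hw' : w.im ≠ 0 := (hDU hw).ne'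
  have hdd : DifferentiableAt ℝ (fderiv ℝ φ) w :=
    h.contDiff_fderiv.differentiable (by simp) w
  have hd1 : ∀ v : ℂ, HasFDerivAt (fun w => I * fderiv ℝ φ w v)
      (I • (fderiv ℝ (fderiv ℝ φ) w).flip v) w := fun v => by
    have := (hdd.hasFDerivAt.clm_apply (hasFDerivAt_const v w)).const_mul I
    simpa using this
  have hd : ∀ v, _ := fun v => ((hd1 v).inner ℝ (h.differentiable w).hasFDerivAt).fderiv
  have hsymm : fderiv ℝ (fderiv ℝ φ) w 1 I = fderiv ℝ (fderiv ℝ φ) w I 1 :=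
    ((contDiff_infty.1 h.1 2).contDiffAt.isSymmSndFDerivAt (by simp)) 1 I
  have hn : ∀ z : ℂ, RCLike.re (inner ℂ z z) = z.re * z.re + z.im * z.im := fun z => by
    simp [-inner_self_eq_norm_sq_to_K]
  rw [hd, hd, hn, hn]
  simp [Wop, Wbar, dw, dwbar, hsymm]
  field_simp
  ring

end IsTestFun

lemma exists_coercive_const {H : Type*} [NormedAddCommGroup H] [InnerProductSpace ℂ H]
    {α : ℝ} (hα : -(1 / 2) < α) :
    ∃ C : ℝ, 0 < C ∧ ∀ a b c : H, ‖b‖ = ‖c‖ → RCLike.re (inner ℂ a (b + c)) = ‖a‖ ^ 2 →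
      ‖a‖ ^ 2 + ‖b‖ ^ 2 + ‖c‖ ^ 2 ≤ C * ‖(α : ℂ) • a + b‖ ^ 2 := by
  rcases le_or_gt α 0 with h0 | h0
  · have hd : 0 < 1 + 2 * α := by linarith
    refine ⟨6 / (1 + 2 * α) ^ 2, by positivity, fun a b c hbc hre => ?_⟩
    have h1 : ‖a‖ ≤ 2 * ‖b‖ := by
      have h2 : ‖a‖ ^ 2 ≤ ‖a‖ * (2 * ‖b‖) := by
        calc ‖a‖ ^ 2 = RCLike.re (inner ℂ a (b + c)) := hre.symm
          _ ≤ ‖a‖ * ‖b + c‖ := re_inner_le_norm a (b + c)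
          _ ≤ ‖a‖ * (2 * ‖b‖) := by
            gcongr
            linarith [norm_add_le b c]
      by_contra! h
      nlinarith [norm_nonneg a, norm_nonneg b]
    have h2 : (1 + 2 * α) * ‖b‖ ≤ ‖(α : ℂ) • a + b‖ := by
      have h3 := norm_sub_norm_le b (-((α : ℂ) • a))
      rw [norm_neg, norm_smul, Complex.norm_real, Real.norm_eq_abs, abs_of_nonpos h0,
        sub_neg_eq_add, add_comm b] at h3
      nlinarith
    have h3 : ((1 + 2 * α) * ‖b‖) ^ 2 ≤ ‖(α : ℂ) • a + b‖ ^ 2 := by gcongr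
    rw [div_mul_eq_mul_div, le_div_iff₀ (by positivity), ← hbc]
    have h4 : ‖a‖ ^ 2 ≤ (2 * ‖b‖) ^ 2 := by gcongr
    have h5 := mul_le_mul_of_nonneg_left h4 (sq_nonneg (1 + 2 * α))
    nlinarith
  · refine ⟨1 / (2 * α) + 4 + 2 * α, by positivity, fun a b c hbc hre => ?_⟩
    have h1 : ‖(α : ℂ) • a + b‖ ^ 2 = ‖c - (α : ℂ) • a‖ ^ 2 + 2 * α * ‖a‖ ^ 2 := by
      rw [@norm_add_sq ℂ, @norm_sub_sq ℂ, ← hre, inner_add_right, inner_smul_left,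
        inner_smul_right, hbc, map_add, inner_re_symm (𝕜 := ℂ) a c]
      simp
      ring
    have h2 : 2 * α * ‖a‖ ^ 2 ≤ ‖(α : ℂ) • a + b‖ ^ 2 := by
      rw [h1]
      linarith [sq_nonneg ‖c - (α : ℂ) • a‖]
    have h3 : ‖b‖ ≤ ‖(α : ℂ) • a + b‖ + α * ‖a‖ := by
      have h4 := norm_sub_le ((α : ℂ) • a + b) ((α : ℂ) • a)
      rwa [add_sub_cancel_left, norm_smul, Complex.norm_real, Real.norm_eq_abs,
        abs_of_pos h0] at h4
    have h4 : ‖b‖ ^ 2 ≤ (‖(α : ℂ) • a + b‖ + α * ‖a‖) ^ 2 := by gcongr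
    have h5 : ‖a‖ ^ 2 ≤ 1 / (2 * α) * ‖(α : ℂ) • a + b‖ ^ 2 := by
      rw [one_div, inv_mul_eq_div, le_div_iff₀ (by positivity)]
      linarith
    rw [← hbc]
    nlinarith [sq_nonneg (‖(α : ℂ) • a + b‖ - α * ‖a‖), mul_le_mul_of_nonneg_left h2 h0.le]

/-- The triples `(φ, Wφ, W̄φ)` in `L²(D)³` with `φ` a test function. -/
def testTriples (D : Set ℂ) :
    Submodule ℂ (Lp ℂ 2 (hypMeasure D) × Lp ℂ 2 (hypMeasure D) × Lp ℂ 2 (hypMeasure D)) where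
  carrier := {x | ∃ φ, IsTestFun D φ ∧ x.1 =ᵐ[hypMeasure D] φ ∧
    x.2.1 =ᵐ[hypMeasure D] Wop φ ∧ x.2.2 =ᵐ[hypMeasure D] Wbar φ}
  zero_mem' := by
    refine ⟨0, IsTestFun.zero, Lp.coeFn_zero _ _ _, ?_, ?_⟩
    · refine (Lp.coeFn_zero _ _ _).trans (Eventually.of_forall fun w => ?_)
      simp [Wop, dw]
    · refine (Lp.coeFn_zero _ _ _).trans (Eventually.of_forall fun w => ?_)
      simp [Wbar, dwbar]
  add_mem' := by
    rintro x y ⟨φ, hφ, h1, h2, h3⟩ ⟨ψ, hψ, k1, k2, k3⟩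
    refine ⟨φ + ψ, hφ.add hψ, (Lp.coeFn_add _ _).trans (h1.add k1), ?_, ?_⟩
    · rw [hφ.Wop_add hψ]
      exact (Lp.coeFn_add _ _).trans (h2.add k2)
    · rw [hφ.Wbar_add hψ]
      exact (Lp.coeFn_add _ _).trans (h3.add k3)
  smul_mem' := by
    rintro c x ⟨φ, hφ, h1, h2, h3⟩
    refine ⟨c • φ, hφ.const_smul c, (Lp.coeFn_smul _ _).trans (h1.const_smul c), ?_, ?_⟩
    · rw [hφ.Wop_const_smul]
      exact (Lp.coeFn_smul _ _).trans (h2.const_smul c)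
    · rw [hφ.Wbar_const_smul]
      exact (Lp.coeFn_smul _ _).trans (h3.const_smul c)

lemma re_inner_sub_re_inner_eq_integral {μ : Measure ℂ} (a b c d : Lp ℂ 2 μ) :
    RCLike.re (inner ℂ a b) - RCLike.re (inner ℂ c d) =
      ∫ w, (RCLike.re (inner ℂ (a w) (b w)) - RCLike.re (inner ℂ (c w) (d w))) ∂μ := by
  rw [integral_sub (L2.integrable_inner (𝕜 := ℂ) a b).re (L2.integrable_inner (𝕜 := ℂ) c d).re,
    integral_re (L2.integrable_inner a b), integral_re (L2.integrable_inner c d),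
    L2.inner_def, L2.inner_def]

lemma testTriples_identities {D : Set ℂ} (hD : IsOpen D) (hDU : D ⊆ UHP)
    {x : Lp ℂ 2 (hypMeasure D) × Lp ℂ 2 (hypMeasure D) × Lp ℂ 2 (hypMeasure D)}
    (hx : x ∈ (testTriples D).topologicalClosure) :
    ‖x.2.1‖ = ‖x.2.2‖ ∧ RCLike.re (inner ℂ x.1 (x.2.1 + x.2.2)) = ‖x.1‖ ^ 2 := by
  have hcl : IsClosed {x : Lp ℂ 2 (hypMeasure D) × Lp ℂ 2 (hypMeasure D) ×
      Lp ℂ 2 (hypMeasure D) |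
      ‖x.2.1‖ = ‖x.2.2‖ ∧ RCLike.re (inner ℂ x.1 (x.2.1 + x.2.2)) = ‖x.1‖ ^ 2} :=
    (isClosed_eq (by fun_prop) (by fun_prop)).inter (isClosed_eq (by fun_prop) (by fun_prop))
  refine closure_minimal ?_ hcl hx
  rintro ⟨a, b, c⟩ ⟨φ, hφ, ha, hb, hc⟩
  dsimp only at ha hb hc
  constructor
  · have h : RCLike.re (inner ℂ b b) - RCLike.re (inner ℂ c c) = 0 := by
      rw [re_inner_sub_re_inner_eq_integral, ← hφ.integral_inner_Wop_sub_inner_Wbar hD hDU]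
      refine integral_congr_ae ?_
      filter_upwards [hb, hc] with w h1 h2
      rw [h1, h2]
    rw [← norm_sq_eq_re_inner, ← norm_sq_eq_re_inner, sub_eq_zero] at h
    exact (sq_eq_sq₀ (norm_nonneg _) (norm_nonneg _)).1 h
  · change RCLike.re (inner ℂ a (b + c)) = ‖a‖ ^ 2
    rw [@norm_sq_eq_re_inner ℂ, ← sub_eq_zero, re_inner_sub_re_inner_eq_integral,
      ← hφ.integral_re_inner_self_Wop_add_Wbar hD hDU]
    refine integral_congr_ae ?_
    filter_upwards [ha, hb, hc, Lp.coeFn_add b c] with w h1 h2 h3 h4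
    rw [h4, Pi.add_apply, h1, h2, h3]

lemma memLp_of_tendsto_eLpNorm_sub {μ : Measure ℂ} {f : ℕ → ℂ → ℂ} {g : ℂ → ℂ}
    (hf : ∀ n, MemLp (f n) 2 μ) (hg : AEStronglyMeasurable g μ)
    (h : Tendsto (fun n => eLpNorm (f n - g) 2 μ) atTop (𝓝 0)) : MemLp g 2 μ := by
  obtain ⟨n, hn⟩ := (h.eventually_lt_const ENNReal.zero_lt_top).exists
  have hsub : MemLp (f n - g) 2 μ := ⟨(hf n).1.sub hg, hn⟩
  simpa using (hf n).sub hsub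

lemma MemW0.exists_toLp_mem {D : Set ℂ} (hDU : D ⊆ UHP) {u Wu Wbu : ℂ → ℂ}
    (h : MemW0 D u Wu Wbu) :
    ∃ (h1 : MemLp u 2 (hypMeasure D)) (h2 : MemLp Wu 2 (hypMeasure D))
      (h3 : MemLp Wbu 2 (hypMeasure D)),
      (h1.toLp u, h2.toLp Wu, h3.toLp Wbu) ∈ (testTriples D).topologicalClosure := by
  obtain ⟨m1, m2, m3, φ, hφ, t1, t2, t3⟩ := h
  rw [tendsto_hNormSq_zero_iff] at t1 t2 t3
  have h1 := memLp_of_tendsto_eLpNorm_sub (fun n => (hφ n).memLp hDU)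
    (aestronglyMeasurable_hypMeasure m1) t1
  have h2 := memLp_of_tendsto_eLpNorm_sub (fun n => (hφ n).memLp_Wop hDU)
    (aestronglyMeasurable_hypMeasure m2) t2
  have h3 := memLp_of_tendsto_eLpNorm_sub (fun n => (hφ n).memLp_Wbar hDU)
    (aestronglyMeasurable_hypMeasure m3) t3
  refine ⟨h1, h2, h3, ?_⟩
  have l1 := (Lp.tendsto_Lp_iff_tendsto_eLpNorm'' _ (fun n => (hφ n).memLp hDU) _ h1).2 t1
  have l2 := (Lp.tendsto_Lp_iff_tendsto_eLpNorm'' _ (fun n => (hφ n).memLp_Wop hDU) _ h2).2 t2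
  have l3 := (Lp.tendsto_Lp_iff_tendsto_eLpNorm'' _ (fun n => (hφ n).memLp_Wbar hDU) _ h3).2 t3
  refine mem_closure_of_tendsto (l1.prodMk_nhds (l2.prodMk_nhds l3))
    (Eventually.of_forall fun n => ⟨φ n, hφ n, ((hφ n).memLp hDU).coeFn_toLp,
      ((hφ n).memLp_Wop hDU).coeFn_toLp, ((hφ n).memLp_Wbar hDU).coeFn_toLp⟩)

lemma memW0_of_mem_closure {D : Set ℂ}
    {x : Lp ℂ 2 (hypMeasure D) × Lp ℂ 2 (hypMeasure D) × Lp ℂ 2 (hypMeasure D)}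
    (hx : x ∈ (testTriples D).topologicalClosure) : MemW0 D x.1 x.2.1 x.2.2 := by
  obtain ⟨y, hy, hlim⟩ := mem_closure_iff_seq_limit.1 hx
  choose φ hφ e1 e2 e3 using hy
  refine ⟨(Lp.stronglyMeasurable _).aestronglyMeasurable,
    (Lp.stronglyMeasurable _).aestronglyMeasurable,
    (Lp.stronglyMeasurable _).aestronglyMeasurable, φ, hφ, ?_, ?_, ?_⟩
  · rw [tendsto_hNormSq_zero_iff]
    refine ((Lp.tendsto_Lp_iff_tendsto_eLpNorm' _ _).1
      ((continuous_fst.tendsto x).comp hlim)).congr fun n => eLpNorm_congr_ae ?_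
    exact (e1 n).sub (ae_eq_refl _)
  · rw [tendsto_hNormSq_zero_iff]
    refine ((Lp.tendsto_Lp_iff_tendsto_eLpNorm' _ _).1
      (((continuous_fst.comp continuous_snd).tendsto x).comp hlim)).congr
      fun n => eLpNorm_congr_ae ?_
    exact (e2 n).sub (ae_eq_refl _)
  · rw [tendsto_hNormSq_zero_iff]
    refine ((Lp.tendsto_Lp_iff_tendsto_eLpNorm' _ _).1
      (((continuous_snd.comp continuous_snd).tendsto x).comp hlim)).congr
      fun n => eLpNorm_congr_ae ?_
    exact (e3 n).sub (ae_eq_refl _)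

lemma hNormSq_eq_ofReal_norm_toLp_sq {D : Set ℂ} {f : ℂ → ℂ} (hf : MemLp f 2 (hypMeasure D)) :
    hNormSq D f = ENNReal.ofReal (‖hf.toLp f‖ ^ 2) := by
  rw [hNormSq_eq_eLpNorm_sq, Lp.norm_toLp, ENNReal.ofReal_pow ENNReal.toReal_nonneg,
    ENNReal.ofReal_toReal hf.2.ne]

/-- The operator `α + W` on triples `(u, Wu, W̄u)`. -/
def alphaAddW (D : Set ℂ) (α : ℝ) :
    Lp ℂ 2 (hypMeasure D) × Lp ℂ 2 (hypMeasure D) × Lp ℂ 2 (hypMeasure D) →L[ℂ]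
      Lp ℂ 2 (hypMeasure D) :=
  (α : ℂ) • ContinuousLinearMap.fst ℂ _ _ +
    (ContinuousLinearMap.fst ℂ _ _).comp (ContinuousLinearMap.snd ℂ _ _)

lemma alphaAddW_apply (D : Set ℂ) (α : ℝ)
    (x : Lp ℂ 2 (hypMeasure D) × Lp ℂ 2 (hypMeasure D) × Lp ℂ 2 (hypMeasure D)) :
    alphaAddW D α x = (α : ℂ) • x.1 + x.2.1 := rfl

lemma isClosed_alphaAddW_image {D : Set ℂ} (hD : IsOpen D) (hDU : D ⊆ UHP) {α : ℝ}
    (hα : -(1 / 2) < α) :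
    IsClosed (alphaAddW D α '' ((testTriples D).topologicalClosure : Set _)) := by
  obtain ⟨C, hC, hest⟩ := exists_coercive_const (H := Lp ℂ 2 (hypMeasure D)) hα
  have hcomp : CompleteSpace (testTriples D).topologicalClosure :=
    (testTriples D).isClosed_topologicalClosure.completeSpace_coe
  let T := (alphaAddW D α).comp (testTriples D).topologicalClosure.subtypeL
  have hT : AntilipschitzWith (Real.toNNReal (Real.sqrt C)) T := by
    refine AddMonoidHomClass.antilipschitz_of_bound T fun x => ?_
    obtain ⟨⟨a, b, c⟩, hx⟩ := x
    have hid := testTriples_identities hD hDU hx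
    have hle := hest a b c hid.1 hid.2
    change max ‖a‖ (max ‖b‖ ‖c‖) ≤ _ * ‖(α : ℂ) • a + b‖
    rw [Real.coe_toNNReal _ (Real.sqrt_nonneg _)]
    have hr : 0 ≤ Real.sqrt C * ‖(α : ℂ) • a + b‖ := by positivity
    have hsq : (Real.sqrt C * ‖(α : ℂ) • a + b‖) ^ 2 = C * ‖(α : ℂ) • a + b‖ ^ 2 := by
      rw [mul_pow, Real.sq_sqrt hC.le]
    refine max_le ?_ (max_le ?_ ?_) <;> refine (sq_le_sq₀ (norm_nonneg _) hr).1 ?_ <;>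
      nlinarith [sq_nonneg ‖a‖, sq_nonneg ‖b‖, sq_nonneg ‖c‖]
  rw [Set.image_eq_range]
  exact hT.isClosed_range T.uniformContinuous

/-- if `α > -1/2` there is `C > 0` with
`‖u‖² + ‖Wu‖² + ‖W̄u‖² ≤ C ‖(α+W)u‖²` on `W₀`; consequently `W + α : W₀ → L²(D)`
is injective and has closed range. -/
theorem coercive_estimate_and_closed_range (D : Set ℂ) (hD : IsOpen D) (hDU : D ⊆ UHP)
    (hbd : Bornology.IsBounded D) (α : ℝ) (hα : -(1 / 2) < α) :
    (∃ C : ℝ, 0 < C ∧ ∀ u Wu Wbu : ℂ → ℂ, MemW0 D u Wu Wbu →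
        hNormSq D u + hNormSq D Wu + hNormSq D Wbu
          ≤ ENNReal.ofReal C * hNormSq D (fun w => (α : ℂ) * u w + Wu w)) ∧
    (∀ u Wu Wbu : ℂ → ℂ, MemW0 D u Wu Wbu →
        hNormSq D (fun w => (α : ℂ) * u w + Wu w) = 0 → hNormSq D u = 0) ∧
    (∀ (u Wu Wbu : ℕ → ℂ → ℂ) (f : ℂ → ℂ),
        AEStronglyMeasurable f (volume.restrict D) →
        (∀ n, MemW0 D (u n) (Wu n) (Wbu n)) →
        Tendsto (fun n => hNormSq D (fun w => ((α : ℂ) * u n w + Wu n w) - f w))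
          atTop (𝓝 0) →
        ∃ v Wv Wbv : ℂ → ℂ, MemW0 D v Wv Wbv ∧
          hNormSq D (fun w => ((α : ℂ) * v w + Wv w) - f w) = 0) := by
  have hfun : ∀ {u Wu : ℂ → ℂ} (h1 : MemLp u 2 (hypMeasure D))
      (h2 : MemLp Wu 2 (hypMeasure D)), MemLp (fun w => (α : ℂ) * u w + Wu w) 2 (hypMeasure D) :=
    fun h1 h2 => (h1.const_mul (α : ℂ)).add h2
  have hest : ∃ C : ℝ, 0 < C ∧ ∀ u Wu Wbu : ℂ → ℂ, MemW0 D u Wu Wbu →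
      hNormSq D u + hNormSq D Wu + hNormSq D Wbu
        ≤ ENNReal.ofReal C * hNormSq D (fun w => (α : ℂ) * u w + Wu w) := by
    obtain ⟨C, hC, hest⟩ := exists_coercive_const (H := Lp ℂ 2 (hypMeasure D)) hα
    refine ⟨C, hC, fun u Wu Wbu h => ?_⟩
    obtain ⟨h1, h2, h3, hx⟩ := h.exists_toLp_mem hDU
    have hid := testTriples_identities hD hDU hx
    rw [hNormSq_eq_ofReal_norm_toLp_sq h1, hNormSq_eq_ofReal_norm_toLp_sq h2,
      hNormSq_eq_ofReal_norm_toLp_sq h3, hNormSq_eq_ofReal_norm_toLp_sq (hfun h1 h2),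
      ← ENNReal.ofReal_add (by positivity) (by positivity),
      ← ENNReal.ofReal_add (by positivity) (by positivity), ← ENNReal.ofReal_mul hC.le]
    exact ENNReal.ofReal_le_ofReal (hest _ _ _ hid.1 hid.2)
  refine ⟨hest, fun u Wu Wbu h h0 => ?_, fun u Wu Wbu f hf h hlim => ?_⟩
  · obtain ⟨C, -, hC⟩ := hest
    have hle := hC u Wu Wbu h
    rw [h0, mul_zero, nonpos_iff_eq_zero] at hle
    simp only [add_eq_zero] at hle
    exact hle.1.1
  · choose h1 h2 h3 hx using fun n => (h n).exists_toLp_mem hDU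
    rw [tendsto_hNormSq_zero_iff] at hlim
    have hfL : MemLp f 2 (hypMeasure D) := memLp_of_tendsto_eLpNorm_sub
      (fun n => hfun (h1 n) (h2 n)) (aestronglyMeasurable_hypMeasure hf) hlim
    have hlim' := (Lp.tendsto_Lp_iff_tendsto_eLpNorm'' _
      (fun n => hfun (h1 n) (h2 n)) _ hfL).2 hlim
    obtain ⟨x, hxS, hxf⟩ := (isClosed_alphaAddW_image hD hDU hα).mem_of_tendsto hlim'
      (Eventually.of_forall fun n => ⟨_, hx n, rfl⟩)
    refine ⟨x.1, x.2.1, x.2.2, memW0_of_mem_closure hxS, ?_⟩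
    have hae : (fun w => ((α : ℂ) * x.1 w + x.2.1 w) - f w) =ᵐ[hypMeasure D] 0 := by
      rw [alphaAddW_apply] at hxf
      filter_upwards [hfL.coeFn_toLp, Lp.coeFn_add ((α : ℂ) • x.1) x.2.1,
        Lp.coeFn_smul (α : ℂ) x.1] with w k1 k2 k3
      rw [← hxf, k2, Pi.add_apply, k3] at k1
      simpa [sub_eq_zero] using k1
    rw [hNormSq_eq_eLpNorm_sq, eLpNorm_congr_ae hae]
    simp
end
end

section
/- Let D be a precompact smooth domain in the upper half-plane and α ∈ ℝ. If u ∈ W₀ satisfies (W + α)u = 0, then u = 0. (Equivalently: if s^α u is holomorphic on D and u lies in the closure of C_c^∞(D) in the first-order Sobolev norm, then u vanishes identically.) -/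
open MeasureTheory Complex Filter Topology Metric
open scoped ENNReal NNReal InnerProductSpace

noncomputable section

theorem integral_fderiv_mul_fderiv_comm {f g : ℂ → ℂ} (hf : ContDiff ℝ (⊤ : ℕ∞) f)
    (hfc : HasCompactSupport f) (hg : ContDiff ℝ (⊤ : ℕ∞) g) (v w : ℂ) :
    ∫ x, fderiv ℝ f x v * fderiv ℝ g x w = ∫ x, fderiv ℝ f x w * fderiv ℝ g x v := by
  have hd {h : ℂ → ℂ} (hh : ContDiff ℝ (⊤ : ℕ∞) h) (z : ℂ) :
      ContDiff ℝ (⊤ : ℕ∞) (fun x => fderiv ℝ h x z) :=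
    (hh.fderiv_right (m := (⊤ : ℕ∞)) (by simp)).clm_apply contDiff_const
  have hfv (z : ℂ) : HasCompactSupport (fun x => fderiv ℝ f x z) := hfc.fderiv_apply (𝕜 := ℝ) z
  have key (v w : ℂ) : ∫ x, f x * fderiv ℝ (fun y => fderiv ℝ g y w) x v
      = -∫ x, fderiv ℝ f x v * fderiv ℝ g x w := by
    apply integral_mul_fderiv_eq_neg_fderiv_mul_of_integrable
    · exact ((hd hf v).continuous.mul (hd hg w).continuous).integrable_of_hasCompactSupport
        (hfv v).mul_right
    · exact (hf.continuous.mul (hd (hd hg w) v).continuous).integrable_of_hasCompactSupport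
        hfc.mul_right
    · exact (hf.continuous.mul (hd hg w).continuous).integrable_of_hasCompactSupport
        hfc.mul_right
    · exact fun x _ => (hf.differentiable (by simp)) x
    · exact fun x _ => ((hd hg w).differentiable (by simp)) x
  have hsymm (x : ℂ) : fderiv ℝ (fun y => fderiv ℝ g y w) x v
      = fderiv ℝ (fun y => fderiv ℝ g y v) x w := by
    have h2 : DifferentiableAt ℝ (fderiv ℝ g) x :=
      ((hg.fderiv_right (m := (⊤ : ℕ∞)) (by simp)).differentiable (by simp)) x
    have h3 : IsSymmSndFDerivAt ℝ g x :=
      hg.contDiffAt.isSymmSndFDerivAt (by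
        rw [minSmoothness_of_isRCLikeNormedField]
        exact WithTop.coe_le_coe.2 le_top)
    rw [fderiv_clm_apply h2 (differentiableAt_const _),
      fderiv_clm_apply h2 (differentiableAt_const _)]
    simpa using h3.eq v w
  have h := key v w
  simp_rw [hsymm] at h
  exact neg_injective (h.symm.trans (key w v))

theorem integrable_norm_sq_of_hasCompactSupport {g : ℂ → ℂ} (hg : Continuous g)
    (hgc : HasCompactSupport g) : Integrable (fun x => ‖g x‖ ^ 2) := by
  apply (hg.norm.pow 2).integrable_of_hasCompactSupport
  refine hgc.mono fun x hx h0 => hx ?_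
  simp [h0]

theorem fderiv_conj_apply {f : ℂ → ℂ} {x : ℂ} (hf : DifferentiableAt ℝ f x) (v : ℂ) :
    fderiv ℝ (fun y => (starRingEnd ℂ) (f y)) x v = (starRingEnd ℂ) (fderiv ℝ f x v) := by
  have h := (conjCLE.toContinuousLinearMap.hasFDerivAt (x := f x)).comp x hf.hasFDerivAt
  have h' : HasFDerivAt (fun y => (starRingEnd ℂ) (f y))
      (conjCLE.toContinuousLinearMap.comp (fderiv ℝ f x)) x := h
  rw [h'.fderiv]
  simp

/-- For compactly supported functions the `L²` norm of `∂f/∂w` controls that of the gradient. -/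
theorem integral_norm_sq_fderiv_le {f : ℂ → ℂ} (hf : ContDiff ℝ (⊤ : ℕ∞) f)
    (hfc : HasCompactSupport f) :
    ∫ x, ‖fderiv ℝ f x 1‖ ^ 2 ≤ 4 * ∫ x, ‖dw f x‖ ^ 2 := by
  have hd (z : ℂ) : Continuous (fun x => fderiv ℝ f x z) :=
    ((hf.fderiv_right (m := (⊤ : ℕ∞)) (by simp)).clm_apply contDiff_const).continuous
  have hfv (z : ℂ) : HasCompactSupport (fun x => fderiv ℝ f x z) := hfc.fderiv_apply (𝕜 := ℝ) z
  have hint (z z' : ℂ) :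
      Integrable (fun x => fderiv ℝ f x z * (starRingEnd ℂ) (fderiv ℝ f x z')) :=
    ((hd z).mul (continuous_conj.comp (hd z'))).integrable_of_hasCompactSupport (hfv z).mul_right
  have hint2 (z : ℂ) : Integrable (fun x => ‖fderiv ℝ f x z‖ ^ 2) :=
    integrable_norm_sq_of_hasCompactSupport (hd z) (hfv z)
  have hcross : ∫ x, (fderiv ℝ f x 1 * (starRingEnd ℂ) (fderiv ℝ f x I)).im = 0 := by
    have h := integral_fderiv_mul_fderiv_comm hf hfc
      (g := fun y => (starRingEnd ℂ) (f y)) (conjCLE.contDiff.comp hf) 1 I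
    simp_rw [fun x v => fderiv_conj_apply ((hf.differentiable (by simp)) x) v] at h
    have h1 : ∫ x, fderiv ℝ f x I * (starRingEnd ℂ) (fderiv ℝ f x 1)
        = (starRingEnd ℂ) (∫ x, fderiv ℝ f x 1 * (starRingEnd ℂ) (fderiv ℝ f x I)) := by
      rw [← integral_conj]
      simp [mul_comm]
    have h2 := conj_eq_iff_im.1 (h.trans h1).symm
    rw [← h2]
    exact integral_im (hint 1 I)
  have hpt (x : ℂ) : 4 * ‖dw f x‖ ^ 2 = ‖fderiv ℝ f x 1‖ ^ 2 + ‖fderiv ℝ f x I‖ ^ 2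
      - 2 * (fderiv ℝ f x 1 * (starRingEnd ℂ) (fderiv ℝ f x I)).im := by
    simp only [dw, ← normSq_eq_norm_sq, normSq_apply]
    simp
    ring
  rw [← integral_const_mul]
  simp_rw [hpt]
  have him : Integrable fun x => 2 * (fderiv ℝ f x 1 * (starRingEnd ℂ) (fderiv ℝ f x I)).im :=
    (hint 1 I).im.const_mul 2
  have hadd : Integrable fun x => ‖fderiv ℝ f x 1‖ ^ 2 + ‖fderiv ℝ f x I‖ ^ 2 :=
    (hint2 1).add (hint2 I)
  rw [integral_sub hadd him, integral_add (hint2 1) (hint2 I), integral_const_mul, hcross]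
  have : 0 ≤ ∫ x, ‖fderiv ℝ f x I‖ ^ 2 := integral_nonneg fun x => by positivity
  linarith

/-- Poincaré inequality in the direction of the real axis. -/
theorem integral_norm_sq_le_fderiv {f : ℂ → ℂ} (hf : ContDiff ℝ (⊤ : ℕ∞) f)
    (hfc : HasCompactSupport f) {R : ℝ} (hR : ∀ x ∈ tsupport f, ‖x‖ ≤ R) :
    ∫ x, ‖f x‖ ^ 2 ≤ 4 * R ^ 2 * ∫ x, ‖fderiv ℝ f x 1‖ ^ 2 := by
  have hdiff := hf.differentiable (by simp)
  have hd : Continuous (fun x => fderiv ℝ f x 1) :=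
    ((hf.fderiv_right (m := (⊤ : ℕ∞)) (by simp)).clm_apply contDiff_const).continuous
  have hfv : HasCompactSupport (fun x => fderiv ℝ f x 1) := hfc.fderiv_apply (𝕜 := ℝ) 1
  have hint1 : Integrable (fun x => ‖f x‖ ^ 2) :=
    integrable_norm_sq_of_hasCompactSupport hf.continuous hfc
  have hint2 : Integrable (fun x => ‖fderiv ℝ f x 1‖ ^ 2) :=
    integrable_norm_sq_of_hasCompactSupport hd hfv
  have hder (x : ℂ) : fderiv ℝ (fun y => ‖f y‖ ^ 2) x 1 = 2 * ⟪f x, fderiv ℝ f x 1⟫_ℝ := by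
    rw [(hdiff x).hasFDerivAt.norm_sq.fderiv]
    simp
    ring
  have hre (x : ℂ) : fderiv ℝ (fun y : ℂ => y.re) x 1 = 1 := by
    have : HasFDerivAt (fun y : ℂ => y.re) reCLM x := reCLM.hasFDerivAt
    rw [this.fderiv]
    simp
  have hic : Continuous fun x => 2 * ⟪f x, fderiv ℝ f x 1⟫_ℝ * x.re :=
    (continuous_const.mul (hf.continuous.inner hd)).mul continuous_re
  have hint3 : Integrable fun x => 2 * ⟪f x, fderiv ℝ f x 1⟫_ℝ * x.re := by
    apply hic.integrable_of_hasCompactSupport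
    refine hfc.mono fun x hx h0 => hx ?_
    simp [h0]
  have hint4 : Integrable fun x => ‖f x‖ ^ 2 * x.re := by
    apply ((hf.continuous.norm.pow 2).mul continuous_re).integrable_of_hasCompactSupport
    refine hfc.mono fun x hx h0 => hx ?_
    simp [h0]
  have hparts := integral_mul_fderiv_eq_neg_fderiv_mul_of_integrable (μ := volume)
    (f := fun y => ‖f y‖ ^ 2) (g := fun y : ℂ => y.re) (v := 1)
    (by simpa only [hder] using hint3) (by simpa only [hre, mul_one] using hint1)
    hint4
    (fun x _ => (hdiff x).norm_sq ℝ) (fun x _ => reCLM.differentiableAt)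
  simp only [hder, hre, mul_one] at hparts
  have hpt (x : ℂ) : -(2 * ⟪f x, fderiv ℝ f x 1⟫_ℝ * x.re)
      ≤ 1 / 2 * ‖f x‖ ^ 2 + 2 * R ^ 2 * ‖fderiv ℝ f x 1‖ ^ 2 := by
    by_cases hx : x ∈ tsupport f
    · have h1 := abs_real_inner_le_norm (f x) (fderiv ℝ f x 1)
      have h2 := (abs_re_le_norm x).trans (hR x hx)
      have h3 : |⟪f x, fderiv ℝ f x 1⟫_ℝ * x.re| ≤ ‖f x‖ * ‖fderiv ℝ f x 1‖ * R := by
        rw [abs_mul]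
        gcongr
      have h4 := neg_le_of_abs_le h3
      nlinarith [sq_nonneg (‖f x‖ - 2 * (R * ‖fderiv ℝ f x 1‖))]
    · rw [image_eq_zero_of_notMem_tsupport hx]
      simp
      positivity
  have hle := integral_mono hint3.neg ((hint1.const_mul (1 / 2)).add (hint2.const_mul (2 * R ^ 2)))
    hpt
  simp only [Pi.neg_apply, Pi.add_apply] at hle
  rw [integral_neg, ← hparts, integral_add (hint1.const_mul _) (hint2.const_mul _),
    integral_const_mul, integral_const_mul] at hle
  linarith

theorem lintegral_nnnorm_sq_le_dw {f : ℂ → ℂ} (hf : ContDiff ℝ (⊤ : ℕ∞) f)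
    (hfc : HasCompactSupport f) {R : ℝ} (hR : ∀ x ∈ tsupport f, ‖x‖ ≤ R) :
    ∫⁻ x, (‖f x‖₊ : ℝ≥0∞) ^ 2
      ≤ ENNReal.ofReal (16 * R ^ 2) * ∫⁻ x, (‖dw f x‖₊ : ℝ≥0∞) ^ 2 := by
  have hd (z : ℂ) : Continuous (fun x => fderiv ℝ f x z) :=
    ((hf.fderiv_right (m := (⊤ : ℕ∞)) (by simp)).clm_apply contDiff_const).continuous
  have hdw : Continuous (dw f) := ((hd 1).sub (continuous_const.mul (hd I))).div_const 2
  have hdwc : HasCompactSupport (dw f) := by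
    apply (hfc.fderiv (𝕜 := ℝ)).mono
    intro x hx h0
    apply hx
    simp [dw, h0]
  have hconv {g : ℂ → ℂ} (hg : Continuous g) (hgc : HasCompactSupport g) :
      ∫⁻ x, (‖g x‖₊ : ℝ≥0∞) ^ 2 = ENNReal.ofReal (∫ x, ‖g x‖ ^ 2) := by
    rw [ofReal_integral_eq_lintegral_ofReal]
    · simp_rw [ENNReal.ofReal_pow (norm_nonneg _), ofReal_norm, enorm_eq_nnnorm]
    · exact integrable_norm_sq_of_hasCompactSupport hg hgc
    · exact Eventually.of_forall fun x => by positivity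
  rw [hconv hf.continuous hfc, hconv hdw hdwc, ← ENNReal.ofReal_mul (by positivity)]
  apply ENNReal.ofReal_le_ofReal
  have h1 := integral_norm_sq_le_fderiv hf hfc hR
  have h2 := mul_le_mul_of_nonneg_left (integral_norm_sq_fderiv_le hf hfc)
    (by positivity : 0 ≤ 4 * R ^ 2)
  linarith

/-- Multiplication by `s ^ α` intertwines `2is ∂/∂w` with `W + α`. -/
theorem dw_rpow_im_mul {f : ℂ → ℂ} {w : ℂ} (hf : DifferentiableAt ℝ f w) (hw : 0 < w.im) (α : ℝ) :
    2 * I * (w.im : ℂ) * dw (fun z => ((z.im ^ α : ℝ) : ℂ) * f z) w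
      = ((w.im ^ α : ℝ) : ℂ) * (α * f w + Wop f w) := by
  have him : HasFDerivAt (fun z : ℂ => z.im) imCLM w := imCLM.hasFDerivAt
  have hpow := him.rpow_const (p := α) (Or.inl hw.ne')
  have hofReal : HasFDerivAt (fun z : ℂ => ((z.im ^ α : ℝ) : ℂ))
      (ofRealCLM.comp ((α * w.im ^ (α - 1)) • imCLM)) w :=
    (ofRealCLM.hasFDerivAt (x := w.im ^ α)).comp w hpow
  have hmul := hofReal.mul hf.hasFDerivAt
  have hs : ((w.im ^ α : ℝ) : ℂ) = (w.im : ℂ) * ((w.im ^ (α - 1) : ℝ) : ℂ) := by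
    rw [← ofReal_mul, Real.rpow_sub_one hw.ne', mul_div_cancel₀ _ hw.ne']
  have hfd : fderiv ℝ (fun z => ((z.im ^ α : ℝ) : ℂ) * f z) w = _ := hmul.fderiv
  simp only [dw, Wop, hfd]
  simp
  simp only [← ofReal_mul, hs]
  push_cast
  linear_combination (-(w.im : ℂ) * α * ((w.im ^ (α - 1) : ℝ) : ℂ) * f w) * I_sq

theorem IsTestFun.rpow_im_mul {D : Set ℂ} (hDU : D ⊆ UHP) {f : ℂ → ℂ} (hf : IsTestFun D f)
    (α : ℝ) : IsTestFun D (fun z => ((z.im ^ α : ℝ) : ℂ) * f z) := by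
  obtain ⟨hs, hc, hsub⟩ := hf
  have htsub : tsupport (fun z => ((z.im ^ α : ℝ) : ℂ) * f z) ⊆ tsupport f :=
    closure_mono (Function.support_mul_subset_right _ _)
  refine ⟨contDiff_iff_contDiffAt.2 fun x => ?_, hc.mul_left, htsub.trans hsub⟩
  by_cases hx : x ∈ tsupport f
  · have hpos : 0 < x.im := hDU (hsub hx)
    have h1 : ContDiffAt ℝ (⊤ : ℕ∞) (fun z : ℂ => z.im ^ α) x :=
      imCLM.contDiff.contDiffAt.rpow_const_of_ne hpos.ne'
    exact (ofRealCLM.contDiff.contDiffAt.comp x h1).mul hs.contDiffAt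
  · have h0 : (fun z => ((z.im ^ α : ℝ) : ℂ) * f z) =ᶠ[𝓝 x] fun _ => 0 := by
      filter_upwards [notMem_tsupport_iff_eventuallyEq.1 hx] with z hz
      simp [hz]
    exact contDiffAt_const.congr_of_eventuallyEq h0

/-- A priori estimate for `W + α` on test functions. -/
theorem exists_hNormSq_le_Wop (D : Set ℂ) (hD : IsOpen D) (hDU : D ⊆ UHP)
    (hcpt : IsCompact (closure D)) (hcl : closure D ⊆ UHP) (α : ℝ) :
    ∃ C : ℝ, ∀ f, IsTestFun D f →
      hNormSq D f ≤ ENNReal.ofReal C * hNormSq D (fun w => α * f w + Wop f w) := by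
  obtain ⟨R, hR⟩ := hcpt.isBounded.exists_norm_le
  have hcont (β : ℝ) : ContinuousOn (fun w : ℂ => w.im ^ β) (closure D) :=
    continuous_im.continuousOn.rpow_const fun w hw => Or.inl (hcl hw).ne'
  obtain ⟨A, hA⟩ := hcpt.exists_bound_of_continuousOn (hcont (-α - 1))
  obtain ⟨B, hB⟩ := hcpt.exists_bound_of_continuousOn (hcont α)
  refine ⟨A ^ 2 * (16 * R ^ 2 * B ^ 2), fun f hf => ?_⟩
  set ψ : ℂ → ℂ := fun z => ((z.im ^ α : ℝ) : ℂ) * f z with hψ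
  have hψt : IsTestFun D ψ := hf.rpow_im_mul hDU α
  have hsq (z : ℂ) (r : ℝ) : (‖z‖₊ : ℝ≥0∞) ^ 2 * ENNReal.ofReal (r ^ 2)
      = ENNReal.ofReal ((‖z‖ * r) ^ 2) := by
    rw [mul_pow, ENNReal.ofReal_mul (by positivity), ENNReal.ofReal_pow (norm_nonneg _),
      ofReal_norm, enorm_eq_nnnorm]
  have hsq' (z : ℂ) : (‖z‖₊ : ℝ≥0∞) ^ 2 = ENNReal.ofReal (‖z‖ ^ 2) := by
    simpa using hsq z 1
  have h1 : hNormSq D f ≤ ENNReal.ofReal (A ^ 2) * ∫⁻ w, (‖ψ w‖₊ : ℝ≥0∞) ^ 2 := by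
    rw [← lintegral_const_mul' _ _ ENNReal.ofReal_ne_top]
    refine (setLIntegral_mono' hD.measurableSet fun w hw => ?_).trans
      (setLIntegral_le_lintegral D _)
    have hpos : 0 < w.im := hDU hw
    rw [hsq, hsq', ← ENNReal.ofReal_mul (by positivity), ← mul_pow]
    have hAw := hA w (subset_closure hw)
    rw [Real.norm_of_nonneg (by positivity)] at hAw
    have : w.im⁻¹ = w.im ^ (-α - 1) * w.im ^ α := by
      rw [← Real.rpow_add hpos, ← Real.rpow_neg_one]
      ring_nf
    refine ENNReal.ofReal_le_ofReal (pow_le_pow_left₀ (by positivity) ?_ 2)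
    rw [this, hψ]
    simp only [norm_mul, norm_real, Real.norm_of_nonneg (Real.rpow_nonneg hpos.le α)]
    calc ‖f w‖ * (w.im ^ (-α - 1) * w.im ^ α)
        = w.im ^ (-α - 1) * (w.im ^ α * ‖f w‖) := by ring
      _ ≤ A * (w.im ^ α * ‖f w‖) := by gcongr
  have h2 : ∫⁻ w, (‖ψ w‖₊ : ℝ≥0∞) ^ 2
      ≤ ENNReal.ofReal (16 * R ^ 2) * ∫⁻ w, (‖dw ψ w‖₊ : ℝ≥0∞) ^ 2 :=
    lintegral_nnnorm_sq_le_dw hψt.1 hψt.2.1 fun x hx => hR x (subset_closure (hψt.2.2 hx))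
  have h3 : ∫⁻ w, (‖dw ψ w‖₊ : ℝ≥0∞) ^ 2
      ≤ ENNReal.ofReal (B ^ 2) * hNormSq D (fun w => α * f w + Wop f w) := by
    have hsupp : Function.support (fun w => (‖dw ψ w‖₊ : ℝ≥0∞) ^ 2) ⊆ D := by
      intro w hw
      refine hψt.2.2 (tsupport_fderiv_subset ℝ (subset_closure fun h0 => hw ?_))
      simp [dw, h0]
    rw [← setLIntegral_eq_of_support_subset hsupp, hNormSq,
      ← lintegral_const_mul' _ _ ENNReal.ofReal_ne_top]
    refine setLIntegral_mono' hD.measurableSet fun w hw => ?_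
    have hpos : 0 < w.im := hDU hw
    rw [hsq, hsq', ← ENNReal.ofReal_mul (by positivity), ← mul_pow]
    have hBw := hB w (subset_closure hw)
    rw [Real.norm_of_nonneg (by positivity)] at hBw
    have heq := congrArg norm (dw_rpow_im_mul ((hf.1.differentiable (by simp)) w) hpos α)
    simp only [norm_mul, norm_real, Real.norm_of_nonneg (Real.rpow_nonneg hpos.le α),
      Real.norm_of_nonneg hpos.le, norm_I, Complex.norm_ofNat, mul_one] at heq
    gcongr
    have : ‖dw ψ w‖ ≤ 2 * ‖dw ψ w‖ := by linarith [norm_nonneg (dw ψ w)]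
    calc ‖dw ψ w‖ ≤ 2 * ‖dw ψ w‖ := this
      _ = w.im ^ α * (‖α * f w + Wop f w‖ * w.im⁻¹) := by
        rw [← mul_assoc, ← heq]
        field_simp
        rfl
      _ ≤ B * (‖α * f w + Wop f w‖ * w.im⁻¹) := by gcongr
  calc hNormSq D f
      ≤ ENNReal.ofReal (A ^ 2) * (ENNReal.ofReal (16 * R ^ 2) * (ENNReal.ofReal (B ^ 2)
          * hNormSq D (fun w => α * f w + Wop f w))) := by
        refine h1.trans ?_
        gcongr
        refine h2.trans ?_
        gcongr
    _ = _ := by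
        rw [ENNReal.ofReal_mul (p := A ^ 2) (by positivity),
          ENNReal.ofReal_mul (p := 16 * R ^ 2) (by positivity)]
        simp only [mul_assoc]

theorem hNormSq_add_le {D : Set ℂ} {f g : ℂ → ℂ}
    (hf : AEStronglyMeasurable f (volume.restrict D)) :
    hNormSq D (fun w => f w + g w) ≤ 2 * hNormSq D f + 2 * hNormSq D g := by
  have hm : AEMeasurable (fun w : ℂ => (‖f w‖₊ : ℝ≥0∞) ^ 2 * ENNReal.ofReal ((w.im)⁻¹ ^ 2))
      (volume.restrict D) :=
    (hf.enorm.pow_const 2).mul (by fun_prop)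
  unfold hNormSq
  rw [← lintegral_const_mul' _ _ (by simp), ← lintegral_const_mul' _ _ (by simp),
    ← lintegral_add_left' (hm.const_mul 2)]
  refine lintegral_mono fun w => ?_
  rw [← mul_assoc, ← mul_assoc, ← add_mul, ← mul_add]
  gcongr
  have h : ‖f w + g w‖₊ ^ 2 ≤ 2 * (‖f w‖₊ ^ 2 + ‖g w‖₊ ^ 2) :=
    (pow_le_pow_left₀ zero_le (nnnorm_add_le _ _) 2).trans add_sq_le
  norm_cast
  exact ENNReal.coe_le_coe.2 h

theorem hNormSq_const_mul (D : Set ℂ) (c : ℂ) (f : ℂ → ℂ) :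
    hNormSq D (fun w => c * f w) = (‖c‖₊ : ℝ≥0∞) ^ 2 * hNormSq D f := by
  unfold hNormSq
  rw [← lintegral_const_mul' _ _ (by simp)]
  simp [mul_pow, mul_assoc]

theorem ae_eq_zero_of_hNormSq_eq_zero {D : Set ℂ} (hD : IsOpen D) (hDU : D ⊆ UHP) {f : ℂ → ℂ}
    (hf : AEStronglyMeasurable f (volume.restrict D)) (h : hNormSq D f = 0) :
    ∀ᵐ w ∂(volume.restrict D), f w = 0 := by
  have hm : AEMeasurable (fun w : ℂ => (‖f w‖₊ : ℝ≥0∞) ^ 2 * ENNReal.ofReal ((w.im)⁻¹ ^ 2))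
      (volume.restrict D) :=
    (hf.enorm.pow_const 2).mul (by fun_prop)
  filter_upwards [(lintegral_eq_zero_iff' hm).1 h, ae_restrict_mem hD.measurableSet] with w hw hwD
  have hpos : 0 < w.im := hDU hwD
  rcases mul_eq_zero.1 hw with h0 | h0
  · simpa using h0
  · exact absurd h0 (ENNReal.ofReal_pos.2 (by positivity)).ne'

/-- on a precompact smooth domain `D` in the upper half-plane, for any
`α ∈ ℝ`, if `u ∈ W₀` satisfies `(W+α)u = 0` then `u = 0`. -/
theorem W_plus_alpha_injective (D : Set ℂ) (hD : IsOpen D) (hDU : D ⊆ UHP)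
    (hcpt : IsCompact (closure D)) (hcl : closure D ⊆ UHP) (α : ℝ)
    (u Wu Wbu : ℂ → ℂ) (hu : MemW0 D u Wu Wbu)
    (hker : ∀ᵐ w ∂(volume.restrict D), (α : ℂ) * u w + Wu w = 0) :
    ∀ᵐ w ∂(volume.restrict D), u w = 0 := by
  obtain ⟨hum, hWum, -, φ, hφ, hlim, hWlim, -⟩ := hu
  obtain ⟨C, hC⟩ := exists_hNormSq_le_Wop D hD hDU hcpt hcl α
  have hφm (n : ℕ) : AEStronglyMeasurable (φ n) (volume.restrict D) :=
    (hφ n).1.continuous.aestronglyMeasurable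
  have hdiff (n : ℕ) : hNormSq D (fun w => α * φ n w + Wop (φ n) w)
      ≤ 2 * ((‖(α : ℂ)‖₊ : ℝ≥0∞) ^ 2 * hNormSq D (fun w => φ n w - u w))
        + 2 * hNormSq D (fun w => Wop (φ n) w - Wu w) := by
    have heq : hNormSq D (fun w => α * φ n w + Wop (φ n) w)
        = hNormSq D (fun w => α * (φ n w - u w) + (Wop (φ n) w - Wu w)) := by
      refine lintegral_congr_ae ?_
      filter_upwards [hker] with w hw
      have : α * φ n w + Wop (φ n) w = α * (φ n w - u w) + (Wop (φ n) w - Wu w) := by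
        linear_combination hw
      simp only [this]
    rw [heq, ← hNormSq_const_mul]
    exact hNormSq_add_le (((hφm n).sub hum).const_mul _)
  have hbound (n : ℕ) : hNormSq D u ≤
      2 * (ENNReal.ofReal C * (2 * ((‖(α : ℂ)‖₊ : ℝ≥0∞) ^ 2 * hNormSq D (fun w => φ n w - u w))
        + 2 * hNormSq D (fun w => Wop (φ n) w - Wu w)))
      + 2 * ((‖(-1 : ℂ)‖₊ : ℝ≥0∞) ^ 2 * hNormSq D (fun w => φ n w - u w)) := by
    have heq : u = fun w => φ n w + -1 * (φ n w - u w) := by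
      ext w
      ring
    calc hNormSq D u = hNormSq D (fun w => φ n w + -1 * (φ n w - u w)) := by rw [← heq]
      _ ≤ 2 * hNormSq D (φ n) + 2 * hNormSq D (fun w => -1 * (φ n w - u w)) :=
        hNormSq_add_le (hφm n)
      _ ≤ _ := by
        rw [hNormSq_const_mul]
        gcongr
        exact (hC _ (hφ n)).trans (by gcongr; exact hdiff n)
  have hmul {a : ℕ → ℝ≥0∞} (ha : Tendsto a atTop (𝓝 0)) {c : ℝ≥0∞} (hc : c ≠ ⊤) :
      Tendsto (fun n => c * a n) atTop (𝓝 0) := by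
    simpa using ENNReal.Tendsto.const_mul ha (Or.inr hc)
  have hrhs := (hmul (hmul (by
      simpa only [add_zero] using
        (hmul (hmul hlim (c := (‖(α : ℂ)‖₊ : ℝ≥0∞) ^ 2) (by simp)) (c := 2) (by simp)).add
          (hmul hWlim (c := 2) (by simp)))
      (c := ENNReal.ofReal C) (by simp)) (c := 2) (by simp)).add
    (hmul (hmul hlim (c := (‖(-1 : ℂ)‖₊ : ℝ≥0∞) ^ 2) (by simp)) (c := 2) (by simp))
  rw [add_zero] at hrhs
  exact ae_eq_zero_of_hNormSq_eq_zero hD hDU hum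
    (le_antisymm (ge_of_tendsto' hrhs hbound) zero_le)
end
end
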